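/- Let H be a Hopf algebra over a field K, t > 0, and u = (u_{ij}) ∈ M_t(H) a multiplicative matrix such that for every k ≥ 1 the left H-comodule U_l^{⊗k} is simple with endomorphism algebra reduced to the scalars, and U_l^{⊗k} ≇ U_l^{⊗l} for k ≠ l. Then the entries u_{ij} generate a free subalgebra of H on t² generators: the K-algebra morphism A(t,t) → H sending the generator x_{ij} to u_{ij} is injective. -/

import Mathlib

open TensorProduct

universe u v

variable (K : Type u) [Field K] (H : Type v) [Ring H] [HopfAlgebra K H]

/-- The tensor product coaction on `A ⊗ B`:
`a ⊗ b ↦ Σ a₍₋₁₎ b₍₋₁₎ ⊗ a₍₀₎ ⊗ b₍₀₎`. -/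
noncomputable def tensorCoaction {A B : Type*} [AddCommGroup A] [Module K A]
    [AddCommGroup B] [Module K B]
    (βA : A →ₗ[K] H ⊗[K] A) (βB : B →ₗ[K] H ⊗[K] B) :
    A ⊗[K] B →ₗ[K] H ⊗[K] (A ⊗[K] B) :=
  TensorProduct.map (LinearMap.mul' K H) LinearMap.id ∘ₗ
    (TensorProduct.tensorTensorTensorComm K H A H B).toLinearMap ∘ₗ
      TensorProduct.map βA βB

/-- A (not necessarily coassociative) left `H`-comodule : a `K`-vector space
equipped with a coaction `β : V → H ⊗ V`. -/
structure Comod where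
  carrier : Type u
  [grp : AddCommGroup carrier]
  [mod : Module K carrier]
  coaction : carrier →ₗ[K] H ⊗[K] carrier

attribute [instance] Comod.grp Comod.mod

namespace Comod

variable {K H}

/-- The trivial comodule `K`, with coaction `x ↦ 1 ⊗ x`. -/
noncomputable def trivial : Comod K H where
  carrier := K
  coaction := TensorProduct.mk K H K 1

/-- Tensor product of comodules. -/
noncomputable def tensor (M N : Comod K H) : Comod K H where
  carrier := M.carrier ⊗[K] N.carrier
  coaction := tensorCoaction K H M.coaction N.coaction

/-- `k`-th tensor power of a comodule. -/
noncomputable def pow (M : Comod K H) : ℕ → Comod K H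
  | 0 => trivial
  | k + 1 => (pow M k).tensor M

/-- Direct sum of `m` copies of a comodule. -/
noncomputable def pi (m : ℕ) (M : Comod K H) : Comod K H where
  carrier := Fin m → M.carrier
  coaction :=
    ∑ i : Fin m,
      LinearMap.lTensor H (LinearMap.single K (fun _ : Fin m => M.carrier) i) ∘ₗ
        M.coaction ∘ₗ LinearMap.proj i

/-- Morphisms of comodules: `K`-linear maps `f` with `(1_H ⊗ f) ∘ β_M = β_N ∘ f`. -/
def Hom (M N : Comod K H) (f : M.carrier →ₗ[K] N.carrier) : Prop :=
  LinearMap.lTensor H f ∘ₗ M.coaction = N.coaction ∘ₗ f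

/-- A comodule is simple if it is nonzero and its only subcomodules are `0` and itself. -/
def IsSimple (M : Comod K H) : Prop :=
  (∃ x : M.carrier, x ≠ 0) ∧
    ∀ W : Submodule K M.carrier,
      (∀ x ∈ W, M.coaction x ∈ LinearMap.range (LinearMap.lTensor H W.subtype)) →
        W = ⊥ ∨ W = ⊤

/-- The `K`-vector space of comodule morphisms `M → N`, as a submodule of the
space of linear maps. -/
def homSubmodule (M N : Comod K H) : Submodule K (M.carrier →ₗ[K] N.carrier) where
  carrier := {f | Hom M N f}
  add_mem' {f g} hf hg := by
    simp only [Set.mem_setOf_eq, Hom] at *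
    rw [LinearMap.lTensor_add, LinearMap.add_comp, LinearMap.comp_add, hf, hg]
  zero_mem' := by
    simp only [Set.mem_setOf_eq, Hom]
    rw [LinearMap.lTensor_zero, LinearMap.zero_comp, LinearMap.comp_zero]
  smul_mem' c f hf := by
    simp only [Set.mem_setOf_eq, Hom] at *
    rw [LinearMap.lTensor_smul, LinearMap.smul_comp, LinearMap.comp_smul, hf]

end Comod

/-- The comodule `K^t` associated to a matrix `u ∈ M_t(H)`:
the coaction is `β(e_i) = ∑ⱼ u_{ij} ⊗ e_j`. -/
noncomputable def matrixComod (t : ℕ) (u : Matrix (Fin t) (Fin t) H) : Comod K H where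
  carrier := Fin t → K
  coaction :=
    (Pi.basisFun K (Fin t)).constr K fun i =>
      ∑ j : Fin t, u i j ⊗ₜ[K] (Pi.single j (1 : K) : Fin t → K)

open Module

/-- **Density** for a family of pairwise non-isomorphic simple modules whose endomorphisms are
scalars: a single ring element realises any prescribed family of linear endomorphisms on finitely
many vectors. -/
theorem exists_smul_eq_of_pairwise_not_bijective {R F ι : Type*} [Ring R] [Field F]
    [DecidableEq ι] {V : ι → Type*} [∀ i, AddCommGroup (V i)] [∀ i, Module R (V i)]
    [∀ i, Module F (V i)] [∀ i, IsSimpleModule R (V i)]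
    (hend : ∀ i (f : V i →ₗ[R] V i), ∃ c : F, ∀ v, f v = c • v)
    (hhom : ∀ i j, i ≠ j → ∀ f : V i →ₗ[R] V j, ¬Function.Bijective f)
    (T : ∀ i, V i →ₗ[F] V i) (s : Finset (Σ i, V i)) :
    ∃ r : R, ∀ x ∈ s, r • x.2 = T x.1 x.2 := by
  classical
  have key : ∀ (φ : End R (Π₀ i, V i)) (i : ι),
      ∃ c : F, ∀ v, φ (DFinsupp.single i v) = DFinsupp.single i (c • v) := by
    intro φ i
    obtain ⟨c, hc⟩ := hend i (DFinsupp.lapply i ∘ₗ φ ∘ₗ DFinsupp.lsingle i)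
    refine ⟨c, fun v => DFinsupp.ext fun j => ?_⟩
    by_cases hij : i = j
    · subst hij
      simpa using hc v
    · have h0 := ((DFinsupp.lapply j ∘ₗ φ ∘ₗ DFinsupp.lsingle i :
        V i →ₗ[R] V j).bijective_or_eq_zero).resolve_left (hhom i j hij _)
      rw [DFinsupp.single_eq_of_ne (Ne.symm hij)]
      exact LinearMap.congr_fun h0 v
  let D : (Π₀ i, V i) →+ (Π₀ i, V i) :=
    DFinsupp.mapRange.addMonoidHom fun i => (T i).toAddMonoidHom
  have hD : ∀ i v, D (DFinsupp.single i v) = DFinsupp.single i (T i v) := fun i v =>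
    DFinsupp.mapRange_single (hf := fun i => map_zero (T i))
  let E : End (End R (Π₀ i, V i)) (Π₀ i, V i) :=
    { D with
      map_smul' := by
        intro φ m
        change D (φ m) = φ (D m)
        induction m using DFinsupp.induction with
        | h0 => simp
        | ha i v m _ _ hm =>
          obtain ⟨c, hc⟩ := key φ i
          rw [map_add, map_add, hc, hD, hm, map_add, map_add, hD, hc, map_smul] }
  obtain ⟨r, hr⟩ := jacobson_density E (s.image fun x : Σ i, V i => DFinsupp.single x.1 x.2)
  refine ⟨r, fun x hx => ?_⟩
  have h : D (DFinsupp.single x.1 x.2) = r • DFinsupp.single x.1 x.2 :=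
    hr _ (Finset.mem_image_of_mem _ hx)
  rw [hD, ← DFinsupp.single_smul] at h
  exact (DFinsupp.single_injective h).symm

section Separation

variable {K H} {V W : Type*} [AddCommGroup V] [Module K V] [AddCommGroup W] [Module K W]

/-- Contraction of the left tensor factor with a linear functional. -/
noncomputable def contractFunctional (f : H →ₗ[K] K) : H ⊗[K] V →ₗ[K] V :=
  (TensorProduct.lid K V).toLinearMap ∘ₗ f.rTensor V

@[simp]
theorem contractFunctional_tmul (f : H →ₗ[K] K) (h : H) (v : V) :
    contractFunctional f (h ⊗ₜ[K] v) = f h • v := by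
  simp [contractFunctional]

theorem contractFunctional_lTensor (f : H →ₗ[K] K) (g : V →ₗ[K] W) (z : H ⊗[K] V) :
    contractFunctional f (g.lTensor H z) = g (contractFunctional f z) := by
  induction z <;> simp_all

theorem eq_of_contractFunctional_eq {z w : H ⊗[K] V}
    (h : ∀ f : H →ₗ[K] K, contractFunctional f z = contractFunctional f w) : z = w := by
  classical
  let b := Basis.ofVectorSpace K H
  refine (TensorProduct.equivFinsuppOfBasisLeft (N := V) b).injective (Finsupp.ext fun i => ?_)
  rw [TensorProduct.equivFinsuppOfBasisLeft_apply, TensorProduct.equivFinsuppOfBasisLeft_apply]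
  exact h (b.coord i)

theorem mem_range_lTensor_subtype {W : Submodule K V} {z : H ⊗[K] V}
    (h : ∀ f : H →ₗ[K] K, contractFunctional f z ∈ W) :
    z ∈ LinearMap.range (W.subtype.lTensor H) := by
  classical
  let b := Basis.ofVectorSpace K H
  let e := TensorProduct.equivFinsuppOfBasisLeft (N := V) b
  rw [← e.symm_apply_apply z, TensorProduct.equivFinsuppOfBasisLeft_symm_apply]
  refine Submodule.sum_mem _ fun i _ => ?_
  have hi : e z i ∈ W := by
    rw [TensorProduct.equivFinsuppOfBasisLeft_apply]
    exact h (b.coord i)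
  exact ⟨b i ⊗ₜ ⟨e z i, hi⟩, by simp⟩

end Separation

namespace Comod

variable {K H}

/-- The operator on a left comodule given by a linear functional on `H`. -/
noncomputable def act (M : Comod K H) (f : H →ₗ[K] K) : End K M.carrier :=
  contractFunctional f ∘ₗ M.coaction

theorem hom_of_comp_act {M N : Comod K H} {g : M.carrier →ₗ[K] N.carrier}
    (h : ∀ f v, g (M.act f v) = N.act f (g v)) : Hom M N g :=
  LinearMap.ext fun v => eq_of_contractFunctional_eq fun f => by
    change contractFunctional f (g.lTensor H (M.coaction v)) = N.act f (g v)
    rw [contractFunctional_lTensor]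
    exact h f v

theorem IsSimple.eq_bot_or_eq_top {M : Comod K H} (hM : M.IsSimple) (W : Submodule K M.carrier)
    (hW : ∀ f, ∀ v ∈ W, M.act f v ∈ W) : W = ⊥ ∨ W = ⊤ :=
  hM.2 W fun v hv => mem_range_lTensor_subtype fun f => hW f v hv

theorem isSimple_trivial : (trivial : Comod K H).IsSimple :=
  ⟨⟨(1 : K), one_ne_zero (α := K)⟩,
    fun W _ => IsSimpleOrder.eq_bot_or_eq_top (α := Submodule K K) W⟩

theorem Hom.rTensor {M N : Comod K H} {f : M.carrier →ₗ[K] N.carrier} (hf : Hom M N f)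
    (P : Comod K H) :
    Hom (M.tensor P) (N.tensor P) (TensorProduct.map f LinearMap.id) := by
  have hnat : ∀ z : (H ⊗[K] M.carrier) ⊗[K] (H ⊗[K] P.carrier),
      (TensorProduct.map f LinearMap.id).lTensor H
        (TensorProduct.map (LinearMap.mul' K H) LinearMap.id
          (TensorProduct.tensorTensorTensorComm K H M.carrier H P.carrier z)) =
      TensorProduct.map (LinearMap.mul' K H) LinearMap.id
        (TensorProduct.tensorTensorTensorComm K H N.carrier H P.carrier
          (TensorProduct.map (f.lTensor H) LinearMap.id z)) := by
    intro z
    refine LinearMap.congr_fun (f := (TensorProduct.map f LinearMap.id).lTensor H ∘ₗ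
        TensorProduct.map (LinearMap.mul' K H) LinearMap.id ∘ₗ
          (TensorProduct.tensorTensorTensorComm K H M.carrier H P.carrier).toLinearMap)
      (g := TensorProduct.map (LinearMap.mul' K H) LinearMap.id ∘ₗ
        (TensorProduct.tensorTensorTensorComm K H N.carrier H P.carrier).toLinearMap ∘ₗ
          TensorProduct.map (f.lTensor H) LinearMap.id) ?_ z
    ext
    simp
  refine TensorProduct.ext' fun m p => ?_
  have hm : f.lTensor H (M.coaction m) = N.coaction (f m) := LinearMap.congr_fun hf m
  change (TensorProduct.map f LinearMap.id).lTensor H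
        (TensorProduct.map (LinearMap.mul' K H) LinearMap.id
          (TensorProduct.tensorTensorTensorComm K H M.carrier H P.carrier
            (M.coaction m ⊗ₜ P.coaction p))) =
      TensorProduct.map (LinearMap.mul' K H) LinearMap.id
        (TensorProduct.tensorTensorTensorComm K H N.carrier H P.carrier
          (N.coaction (f m) ⊗ₜ P.coaction p))
  rw [hnat, TensorProduct.map_tmul, hm, LinearMap.id_apply]

end Comod

section MatrixComod

variable {K H} {t : ℕ} (u : Matrix (Fin t) (Fin t) H)

/-- The ordered product of the entries of `u` at the positions `(a i, b i)`: the matrix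
coefficients of the tensor powers of the comodule defined by `u`. -/
def tensorPowCoeff {k : ℕ} (a b : Fin k → Fin t) : H :=
  (List.ofFn fun i => u (a i) (b i)).prod

theorem tensorPowCoeff_snoc {k : ℕ} (a b : Fin k → Fin t) (i j : Fin t) :
    tensorPowCoeff u (Fin.snoc a i : Fin (k + 1) → Fin t) (Fin.snoc b j : Fin (k + 1) → Fin t) =
      tensorPowCoeff u a b * u i j := by
  rw [tensorPowCoeff, List.ofFn_succ']
  simp [tensorPowCoeff]

/-- Words of length `k + 1` are words of length `k` followed by a letter. -/
def snocProdEquiv (t k : ℕ) : (Fin k → Fin t) × Fin t ≃ (Fin (k + 1) → Fin t) :=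
  (Equiv.prodComm _ _).trans (Fin.snocEquiv fun _ => Fin t)

theorem snocProdEquiv_apply {k : ℕ} (p : (Fin k → Fin t) × Fin t) :
    snocProdEquiv t k p = (Fin.snoc p.1 p.2 : Fin (k + 1) → Fin t) := rfl

theorem comul_tensorPowCoeff
    (hu : ∀ i j, Coalgebra.comul (R := K) (u i j) = ∑ k : Fin t, u i k ⊗ₜ[K] u k j)
    {k : ℕ} (a b : Fin k → Fin t) :
    Coalgebra.comul (R := K) (tensorPowCoeff u a b) =
      ∑ c : Fin k → Fin t, tensorPowCoeff u a c ⊗ₜ[K] tensorPowCoeff u c b := by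
  induction k with
  | zero => simp [tensorPowCoeff, Algebra.TensorProduct.one_def]
  | succ k ih =>
    obtain ⟨⟨a, i⟩, rfl⟩ := (snocProdEquiv t k).surjective a
    obtain ⟨⟨b, j⟩, rfl⟩ := (snocProdEquiv t k).surjective b
    rw [← (snocProdEquiv t k).sum_comp, Fintype.sum_prod_type]
    simp only [snocProdEquiv_apply, tensorPowCoeff_snoc, Bialgebra.comul_mul, ih, hu,
      Finset.sum_mul_sum, Algebra.TensorProduct.tmul_mul_tmul]

theorem counit_tensorPowCoeff
    (hu : ∀ i j, Coalgebra.counit (R := K) (u i j) = if i = j then (1 : K) else 0)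
    {k : ℕ} (a b : Fin k → Fin t) :
    Coalgebra.counit (R := K) (tensorPowCoeff u a b) = if a = b then (1 : K) else 0 := by
  induction k with
  | zero => simp [tensorPowCoeff, Subsingleton.elim a b]
  | succ k ih =>
    obtain ⟨⟨a, i⟩, rfl⟩ := (snocProdEquiv t k).surjective a
    obtain ⟨⟨b, j⟩, rfl⟩ := (snocProdEquiv t k).surjective b
    simp only [EmbeddingLike.apply_eq_iff_eq, Prod.mk.injEq]
    simp only [snocProdEquiv_apply, tensorPowCoeff_snoc, Bialgebra.counit_mul, ih, hu]
    split_ifs <;> simp_all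

/-- The basis of the `k`-th tensor power indexed by words of length `k`. -/
noncomputable def powBasis :
    ∀ k : ℕ, Basis (Fin k → Fin t) K ((matrixComod K H t u).pow k).carrier
  | 0 => (Basis.singleton (Fin 0 → Fin t) K : Basis (Fin 0 → Fin t) K K)
  | k + 1 => ((powBasis k).tensorProduct (Pi.basisFun K (Fin t))).reindex (snocProdEquiv t k)

theorem powBasis_succ (k : ℕ) (p : (Fin k → Fin t) × Fin t) :
    powBasis (K := K) u (k + 1) (snocProdEquiv t k p) =
      powBasis (K := K) u k p.1 ⊗ₜ[K] (Pi.single p.2 (1 : K) : Fin t → K) := by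
  refine (Basis.reindex_apply
    ((powBasis u k).tensorProduct (Pi.basisFun K (Fin t))) (snocProdEquiv t k) _).trans ?_
  rw [Equiv.symm_apply_apply]
  exact (Basis.tensorProduct_apply' _ _ _).trans (by rw [Pi.basisFun_apply])

theorem coaction_matrixComod_single (i : Fin t) :
    (matrixComod K H t u).coaction (Pi.single i (1 : K) : Fin t → K) =
      ∑ j : Fin t, u i j ⊗ₜ[K] (Pi.single j (1 : K) : Fin t → K) := by
  have h := (Pi.basisFun K (Fin t)).constr_basis K
    (fun i => ∑ j : Fin t, u i j ⊗ₜ[K] (Pi.single j (1 : K) : Fin t → K)) i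
  rwa [Pi.basisFun_apply] at h

theorem coaction_powBasis (k : ℕ) (a : Fin k → Fin t) :
    ((matrixComod K H t u).pow k).coaction (powBasis u k a) =
      ∑ b, tensorPowCoeff u a b ⊗ₜ[K] powBasis u k b := by
  induction k with
  | zero =>
    rw [Fintype.sum_unique, Subsingleton.elim a default]
    have h : powBasis (K := K) u 0 default = (1 : K) :=
      Basis.singleton_apply (Fin 0 → Fin t) K default
    rw [h]
    simp [tensorPowCoeff]
    rfl
  | succ k ih =>
    obtain ⟨⟨a, i⟩, rfl⟩ := (snocProdEquiv t k).surjective a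
    rw [powBasis_succ, ← (snocProdEquiv t k).sum_comp, Fintype.sum_prod_type]
    simp only [powBasis_succ]
    change TensorProduct.map (LinearMap.mul' K H) LinearMap.id
      (TensorProduct.tensorTensorTensorComm K H _ H (Fin t → K)
        (((matrixComod K H t u).pow k).coaction (powBasis u k a) ⊗ₜ[K]
          (matrixComod K H t u).coaction (Pi.single i (1 : K) : Fin t → K))) = _
    rw [ih, coaction_matrixComod_single]
    simp only [TensorProduct.sum_tmul, TensorProduct.tmul_sum, map_sum, snocProdEquiv_apply,
      tensorPowCoeff_snoc]
    rw [Finset.sum_comm]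
    rfl

theorem act_powBasis (f : H →ₗ[K] K) (k : ℕ) (a : Fin k → Fin t) :
    ((matrixComod K H t u).pow k).act f (powBasis u k a) =
      ∑ b, f (tensorPowCoeff u a b) • powBasis u k b := by
  simp [Comod.act, coaction_powBasis]

/-- The operators defined by functionals on `H` form an algebra, uniformly in the tensor power. -/
theorem exists_act_eq_lift
    (hcomul : ∀ i j, Coalgebra.comul (R := K) (u i j) = ∑ k : Fin t, u i k ⊗ₜ[K] u k j)
    (hcounit : ∀ i j, Coalgebra.counit (R := K) (u i j) = if i = j then (1 : K) else 0)
    (r : FreeAlgebra K (H →ₗ[K] K)) :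
    ∃ f : H →ₗ[K] K, ∀ k,
      FreeAlgebra.lift K ((matrixComod K H t u).pow k).act r =
        ((matrixComod K H t u).pow k).act f := by
  induction r using FreeAlgebra.induction with
  | grade0 c =>
    refine ⟨c • Coalgebra.counit, fun k => (powBasis u k).ext fun a => ?_⟩
    rw [act_powBasis]
    simp [counit_tensorPowCoeff u hcounit, Algebra.algebraMap_eq_smul_one]
  | grade1 f => exact ⟨f, fun k => by simp⟩
  | mul r s hr hs =>
    obtain ⟨f, hf⟩ := hr
    obtain ⟨g, hg⟩ := hs
    refine ⟨LinearMap.mul' K K ∘ₗ TensorProduct.map g f ∘ₗ Coalgebra.comul,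
      fun k => (powBasis u k).ext fun a => ?_⟩
    rw [act_powBasis, map_mul, hf, hg, Module.End.mul_apply, act_powBasis]
    simp only [map_sum, map_smul, act_powBasis, LinearMap.comp_apply,
      comul_tensorPowCoeff u hcomul, TensorProduct.map_tmul, LinearMap.mul'_apply,
      Finset.smul_sum, Finset.sum_smul, mul_smul]
    exact Finset.sum_comm
  | add r s hr hs =>
    obtain ⟨f, hf⟩ := hr
    obtain ⟨g, hg⟩ := hs
    refine ⟨f + g, fun k => (powBasis u k).ext fun a => ?_⟩
    rw [map_add, hf, hg, LinearMap.add_apply, act_powBasis, act_powBasis, act_powBasis]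
    simp [add_smul, Finset.sum_add_distrib]

/-- Every family of scalars on finitely many matrix coefficients of the tensor powers is the
restriction of a linear functional on `H`. -/
theorem exists_functional_eq_on_tensorPowCoeff
    (hcomul : ∀ i j, Coalgebra.comul (R := K) (u i j) = ∑ k : Fin t, u i k ⊗ₜ[K] u k j)
    (hcounit : ∀ i j, Coalgebra.counit (R := K) (u i j) = if i = j then (1 : K) else 0)
    (hsimple : ∀ k, ((matrixComod K H t u).pow k).IsSimple)
    (hend : ∀ k,
      ∀ f : ((matrixComod K H t u).pow k).carrier →ₗ[K] ((matrixComod K H t u).pow k).carrier,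
        Comod.Hom ((matrixComod K H t u).pow k) ((matrixComod K H t u).pow k) f →
          ∃ c : K, f = c • LinearMap.id)
    (hniso : ∀ k l, k ≠ l →
      ¬∃ f : ((matrixComod K H t u).pow k).carrier →ₗ[K] ((matrixComod K H t u).pow l).carrier,
        Comod.Hom ((matrixComod K H t u).pow k) ((matrixComod K H t u).pow l) f ∧
          Function.Bijective f)
    (χ : ∀ k, (Fin k → Fin t) → (Fin k → Fin t) → K) (s : Finset (Σ k, Fin k → Fin t)) :
    ∃ f : H →ₗ[K] K, ∀ x ∈ s, ∀ b, f (tensorPowCoeff u x.2 b) = χ x.1 x.2 b := by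
  classical
  let V : ℕ → Comod K H := (matrixComod K H t u).pow
  let R := FreeAlgebra K (H →ₗ[K] K)
  let _ : ∀ k, Module R (V k).carrier := fun k =>
    Module.compHom _ (FreeAlgebra.lift K (V k).act).toRingHom
  have hscalar : ∀ k (c : K) (v : (V k).carrier), algebraMap K R c • v = c • v := by
    intro k c v
    change FreeAlgebra.lift K (V k).act (algebraMap K R c) v = c • v
    simp [Algebra.algebraMap_eq_smul_one]
  have hact : ∀ k (f : H →ₗ[K] K) (v : (V k).carrier), FreeAlgebra.ι K f • v = (V k).act f v := by
    intro k f v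
    change FreeAlgebra.lift K (V k).act (FreeAlgebra.ι K f) v = _
    rw [FreeAlgebra.lift_ι_apply]
  let toLin : ∀ k l, ((V k).carrier →ₗ[R] (V l).carrier) → (V k).carrier →ₗ[K] (V l).carrier :=
    fun k l g =>
      { g with
        map_smul' := by
          intro c v
          change g (c • v) = c • g v
          rw [← hscalar, ← hscalar, map_smul] }
  have hhom : ∀ k l (g : (V k).carrier →ₗ[R] (V l).carrier),
      Comod.Hom (V k) (V l) (toLin k l g) := by
    intro k l g
    refine Comod.hom_of_comp_act fun f v => ?_
    change g _ = (V l).act f (g v)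
    rw [← hact, ← hact, map_smul]
  have : ∀ k, IsSimpleModule R (V k).carrier := by
    intro k
    obtain ⟨x, hx⟩ := (hsimple k).1
    have : Nontrivial (V k).carrier := ⟨x, 0, hx⟩
    refine isSimpleModule_iff R _ |>.mpr { eq_bot_or_eq_top := fun W => ?_ }
    let W' : Submodule K (V k).carrier :=
      { W with
        smul_mem' := by
          intro c v hv
          rw [← hscalar]
          exact W.smul_mem _ hv }
    have hW' : W' = ⊥ ∨ W' = ⊤ := (hsimple k).eq_bot_or_eq_top W' fun f v hv => by
      have := W.smul_mem (FreeAlgebra.ι K f) hv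
      rwa [hact] at this
    refine hW'.imp (fun h => ?_) (fun h => ?_) <;>
      exact SetLike.coe_injective (congrArg (fun Z : Submodule K (V k).carrier =>
        (Z : Set (V k).carrier)) h)
  let T : ∀ k, (V k).carrier →ₗ[K] (V k).carrier := fun k =>
    (powBasis u k).constr K fun a => ∑ b, χ k a b • powBasis u k b
  obtain ⟨r, hr⟩ := exists_smul_eq_of_pairwise_not_bijective (R := R) (F := K)
    (V := fun k => (V k).carrier)
    (fun k g => by
      obtain ⟨c, hc⟩ := hend k _ (hhom k k g)
      exact ⟨c, fun v => LinearMap.congr_fun hc v⟩)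
    (fun k l hkl g hg => hniso k l hkl ⟨_, hhom k l g, hg⟩)
    T (s.image fun x : Σ k, Fin k → Fin t => ⟨x.1, powBasis u x.1 x.2⟩)
  obtain ⟨f, hf⟩ := exists_act_eq_lift u hcomul hcounit r
  refine ⟨f, fun x hx b => ?_⟩
  have h : FreeAlgebra.lift K (V x.1).act r (powBasis u x.1 x.2) =
      T x.1 (powBasis u x.1 x.2) := hr _ (Finset.mem_image_of_mem _ hx)
  rw [hf, act_powBasis, Basis.constr_basis] at h
  have h' := congrArg (fun v => (powBasis u x.1).repr v b) h
  simpa only [Basis.repr_sum_self] using h'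

end MatrixComod

/-- Let `u ∈ M_t(H)` be a multiplicative matrix such that the tensor powers `U_l^{⊗k}`
(`k ≥ 1`) of the associated left comodule `U_l = K^t` are simple, pairwise non-isomorphic,
and have endomorphism algebras reduced to the scalars. Then the entries `u_{ij}` generate a
free subalgebra of `H` on `t²` generators: the algebra morphism `A(t,t) → H`,
`x_{ij} ↦ u_{ij}`, is injective. -/
theorem entries_generate_free_subalgebra
    (t : ℕ) (ht : 0 < t) (u : Matrix (Fin t) (Fin t) H)
    (hu_comul : ∀ i j, Coalgebra.comul (R := K) (u i j) = ∑ k : Fin t, u i k ⊗ₜ[K] u k j)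
    (hu_counit : ∀ i j, Coalgebra.counit (R := K) (u i j) = if i = j then (1 : K) else 0)
    (hsimple : ∀ k : ℕ, 1 ≤ k → ((matrixComod K H t u).pow k).IsSimple)
    (hend : ∀ k : ℕ, 1 ≤ k →
      ∀ f : ((matrixComod K H t u).pow k).carrier →ₗ[K] ((matrixComod K H t u).pow k).carrier,
        Comod.Hom ((matrixComod K H t u).pow k) ((matrixComod K H t u).pow k) f →
          ∃ c : K, f = c • LinearMap.id)
    (hniso : ∀ k l : ℕ, 1 ≤ k → 1 ≤ l → k ≠ l →
      ¬∃ f : ((matrixComod K H t u).pow k).carrier →ₗ[K] ((matrixComod K H t u).pow l).carrier,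
        Comod.Hom ((matrixComod K H t u).pow k) ((matrixComod K H t u).pow l) f ∧
          Function.Bijective f) :
    Function.Injective (FreeAlgebra.lift K (fun p : Fin t × Fin t => u p.1 p.2)) := by
  classical
  have hshift : ∀ k l, k ≠ l →
      ¬∃ f : ((matrixComod K H t u).pow k).carrier →ₗ[K] ((matrixComod K H t u).pow l).carrier,
        Comod.Hom ((matrixComod K H t u).pow k) ((matrixComod K H t u).pow l) f ∧
          Function.Bijective f := by
    rintro k l hkl ⟨f, hf, hbij⟩
    refine hniso (k + 1) (l + 1) (by omega) (by omega) (by omega)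
      ⟨_, hf.rTensor (matrixComod K H t u), ?_⟩
    exact (TensorProduct.congr (LinearEquiv.ofBijective f hbij)
      (LinearEquiv.refl K (matrixComod K H t u).carrier)).bijective
  have hsimple' : ∀ k, ((matrixComod K H t u).pow k).IsSimple
    | 0 => Comod.isSimple_trivial
    | k + 1 => hsimple (k + 1) (by omega)
  have hend' : ∀ k,
      ∀ f : ((matrixComod K H t u).pow k).carrier →ₗ[K] ((matrixComod K H t u).pow k).carrier,
        Comod.Hom ((matrixComod K H t u).pow k) ((matrixComod K H t u).pow k) f →
          ∃ c : K, f = c • LinearMap.id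
    | 0, f, _ => ⟨(show K →ₗ[K] K from f) (1 : K), LinearMap.ext_ring (R := K) (M₃ := K)
        (mul_one (M := K) _).symm⟩
    | k + 1, f, hf => hend (k + 1) (by omega) f hf
  have hli : LinearIndependent K fun w : FreeMonoid (Fin t × Fin t) =>
      (w.toList.map fun p => u p.1 p.2).prod := by
    rw [linearIndependent_iff']
    intro s g hg w hw
    let χ : ∀ k, (Fin k → Fin t) → (Fin k → Fin t) → K := fun k a b =>
      if FreeMonoid.ofList (List.ofFn fun i => (a i, b i)) = w then 1 else 0
    obtain ⟨f, hf⟩ := exists_functional_eq_on_tensorPowCoeff u hu_comul hu_counit hsimple' hend'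
      hshift χ (s.image fun v => ⟨_, fun i => (v.toList.get i).1⟩)
    have hfv : ∀ v ∈ s, f (v.toList.map fun p => u p.1 p.2).prod = if v = w then 1 else 0 := by
      intro v hv
      have h := hf _ (Finset.mem_image_of_mem _ hv) fun i => (v.toList.get i).2
      have h1 : (List.ofFn fun i => u (v.toList.get i).1 (v.toList.get i).2) =
          v.toList.map fun p => u p.1 p.2 := by
        conv_rhs => rw [← List.ofFn_get v.toList, List.map_ofFn]
        rfl
      have h2 : FreeMonoid.ofList (List.ofFn fun i =>
          ((v.toList.get i).1, (v.toList.get i).2)) = v := by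
        simp
      simp only [tensorPowCoeff, h1, χ, h2] at h
      exact h
    have h := congrArg f hg
    rw [map_sum, map_zero, Finset.sum_congr rfl fun v hv => by rw [map_smul, hfv v hv]] at h
    simpa [hw] using h
  have hbasis : (FreeAlgebra.lift K fun p : Fin t × Fin t => u p.1 p.2).toLinearMap ∘
      FreeAlgebra.basisFreeMonoid K (Fin t × Fin t) =
        fun w => (w.toList.map fun p => u p.1 p.2).prod := by
    funext w
    simp [FreeAlgebra.basisFreeMonoid, FreeAlgebra.equivMonoidAlgebraFreeMonoid,
      FreeMonoid.lift_apply, map_list_prod, Function.comp_def]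
  exact LinearMap.injective_of_linearIndependent
    (FreeAlgebra.basisFreeMonoid K (Fin t × Fin t)).span_eq (hbasis ▸ hli)
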